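/- For every positive integer d there exists v = v(d) > 0, and for every integer p ≥ d+1 there exists an integer r = r(p,d), such that the following holds. Let F be a finite family of convex sets in ℝ^d, each of diameter at least 1, such that among any p members of F there exist d+1 whose intersection has diameter at least 1. Then there exists a family C of at most r convex sets in ℝ^d, each of diameter at least v, such that every member of F contains at least one element of C. -/

import Mathlib

/-- Finite Ramsey theorem for colourings of the `u`-element subsets of a linear order. -/
theorem exists_monochromatic_subset (κ : Type) [Finite κ] (u m : ℕ) :
    ∃ N : ℕ, ∀ (α : Type) [LinearOrder α] (S : Finset α), N ≤ S.card → ∀ χ : Finset α → κ,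
      ∃ M ⊆ S, M.card = m ∧ ∃ c, ∀ Q ⊆ M, Q.card = u → χ Q = c := by
  classical
  have := Fintype.ofFinite κ
  induction u generalizing m with
  | zero =>
    refine ⟨m, fun α _ S hS χ => ?_⟩
    obtain ⟨M, hM, hc⟩ := Finset.exists_subset_card_eq hS
    refine ⟨M, hM, hc, χ ∅, fun Q _ hQ => ?_⟩
    rw [Finset.card_eq_zero.1 hQ]
  | succ u ih =>
    have chain : ∀ L : ℕ, ∃ N : ℕ, ∀ (α : Type) [LinearOrder α] (S : Finset α), N ≤ S.card →
        ∀ χ : Finset α → κ, ∃ M ⊆ S, M.card = L ∧ ∃ col : α → κ, ∀ a ∈ M, ∀ Q ⊆ M,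
          (∀ b ∈ Q, a < b) → Q.card = u → χ (insert a Q) = col a := by
      intro L
      induction L with
      | zero => exact ⟨0, fun α _ S _ χ => ⟨∅, by simp, rfl, fun _ => χ ∅, by simp⟩⟩
      | succ L ihL =>
        obtain ⟨N₁, hN₁⟩ := ihL
        obtain ⟨N₂, hN₂⟩ := ih N₁
        refine ⟨N₂ + 1, fun α _ S hS χ => ?_⟩
        have hne : S.Nonempty := Finset.card_pos.1 (by omega)
        set a := S.min' hne with ha
        have haS : a ∈ S := S.min'_mem hne
        obtain ⟨M₁, hM₁, hM₁c, c, hc⟩ := hN₂ α (S.erase a)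
          (by rw [Finset.card_erase_of_mem haS]; omega) (fun Q => χ (insert a Q))
        obtain ⟨M, hM, hMc, col, hcol⟩ := hN₁ α M₁ hM₁c.ge χ
        have hlt : ∀ b ∈ M, a < b := fun b hb => by
          have hb' := Finset.mem_erase.1 (hM₁ (hM hb))
          exact lt_of_le_of_ne (S.min'_le b hb'.2) (Ne.symm hb'.1)
        have haM : a ∉ M := fun h => lt_irrefl _ (hlt a h)
        refine ⟨insert a M, ?_, by rw [Finset.card_insert_of_notMem haM, hMc],
          Function.update col a c, ?_⟩
        · exact Finset.insert_subset haS (hM.trans (hM₁.trans (Finset.erase_subset _ _)))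
        · intro b hb Q hQ hbQ hQc
          have haQ : a ∉ Q := fun h => by
            rcases Finset.mem_insert.1 hb with rfl | hb
            · exact lt_irrefl _ (hbQ _ h)
            · exact lt_asymm (hbQ _ h) (hlt b hb)
          have hQM : Q ⊆ M := (Finset.subset_insert_iff_of_notMem haQ).1 hQ
          rcases Finset.mem_insert.1 hb with rfl | hb
          · rw [Function.update_self]
            exact hc Q (hQM.trans hM) hQc
          · rw [Function.update_of_ne (hlt b hb).ne']
            exact hcol b hb Q hQM hbQ hQc
    obtain ⟨N, hN⟩ := chain (Fintype.card κ * m + 1)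
    refine ⟨N, fun α _ S hS χ => ?_⟩
    obtain ⟨M, hM, hMc, col, hcol⟩ := hN α S hS χ
    obtain ⟨c, -, hc⟩ := Finset.exists_lt_card_fiber_of_mul_lt_card_of_maps_to
      (s := M) (t := Finset.univ) (f := col) (n := m) (by simp)
      (by rw [hMc, Finset.card_univ]; omega)
    obtain ⟨M', hM', hM'c⟩ := Finset.exists_subset_card_eq hc.le
    refine ⟨M', fun x hx => hM (Finset.mem_filter.1 (hM' hx)).1, hM'c, c, fun Q hQ hQc => ?_⟩
    have hne : Q.Nonempty := Finset.card_pos.1 (by omega)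
    have hmin := Q.min'_mem hne
    have h := Finset.mem_filter.1 (hM' (hQ hmin))
    rw [← Finset.insert_erase hmin, ← h.2]
    refine hcol _ h.1 _ (fun x hx => (Finset.mem_filter.1
      (hM' (hQ (Finset.erase_subset _ _ hx)))).1) (fun b hb => ?_) ?_
    · have hb' := Finset.mem_erase.1 hb
      exact lt_of_le_of_ne (Q.min'_le b hb'.2) (Ne.symm hb'.1)
    · rw [Finset.card_erase_of_mem hmin, hQc]; rfl

section MinNorm

variable {V : Type*} [NormedAddCommGroup V] [InnerProductSpace ℝ V]

open Classical in
/-- A point of `K` of minimal norm, when there is one. -/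
noncomputable def minNormPoint (K : Set V) : V :=
  if h : ∃ x ∈ K, ∀ y ∈ K, ‖x‖ ≤ ‖y‖ then h.choose else 0

theorem eq_minNormPoint {K : Set V} (hK : Convex ℝ K) {x : V} (hx : x ∈ K)
    (hmin : ∀ y ∈ K, ‖x‖ ≤ ‖y‖) : x = minNormPoint K := by
  have h : ∃ x ∈ K, ∀ y ∈ K, ‖x‖ ≤ ‖y‖ := ⟨x, hx, hmin⟩
  rw [minNormPoint, dif_pos h]
  obtain ⟨hz, hzmin⟩ := h.choose_spec
  set z := h.choose
  have hxz : ‖x‖ = ‖z‖ := le_antisymm (hmin z hz) (hzmin x hx)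
  by_contra hne
  have hmid : (1 / 2 : ℝ) • x + (1 / 2 : ℝ) • z ∈ K :=
    hK hx hz (by norm_num) (by norm_num) (by norm_num)
  have hlt : ‖(1 / 2 : ℝ) • x + (1 / 2 : ℝ) • z‖ < ‖x‖ :=
    norm_combo_lt_of_ne le_rfl hxz.ge hne (by norm_num) (by norm_num) (by norm_num)
  exact hlt.not_ge (hmin _ hmid)

variable [FiniteDimensional ℝ V]

theorem minNormPoint_spec {K : Set V} (hcl : IsClosed K) (hne : K.Nonempty) :
    minNormPoint K ∈ K ∧ ∀ y ∈ K, ‖minNormPoint K‖ ≤ ‖y‖ := by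
  have h : ∃ x ∈ K, ∀ y ∈ K, ‖x‖ ≤ ‖y‖ := by
    have := FiniteDimensional.proper_real V
    obtain ⟨x, hx, hd⟩ := hcl.exists_infDist_eq_dist hne 0
    refine ⟨x, hx, fun y hy => ?_⟩
    have := Metric.infDist_le_dist_of_mem (x := (0 : V)) hy
    rw [hd] at this
    simpa using this
  rw [minNormPoint, dif_pos h]
  exact h.choose_spec

/-- The minimal-norm point of an intersection of `dim V + 1` closed convex sets is already the
minimal-norm point of the intersection of some `dim V` of them. -/
theorem exists_minNormPoint_iInter_ne_mem (K : Fin (Module.finrank ℝ V + 1) → Set V)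
    (hcl : ∀ l, IsClosed (K l)) (hconv : ∀ l, Convex ℝ (K l)) (hne : (⋂ l, K l).Nonempty) :
    ∃ l, minNormPoint (⋂ m, ⋂ (_ : m ≠ l), K m) ∈ K l := by
  classical
  set x := minNormPoint (⋂ l, K l)
  obtain ⟨hx, hxmin⟩ := minNormPoint_spec (isClosed_iInter hcl) hne
  rw [Set.mem_iInter] at hx
  have hx' : ∀ l, x ∈ ⋂ m, ⋂ (_ : m ≠ l), K m := fun l => by
    simp only [Set.mem_iInter]; exact fun m _ => hx m
  have hspec := fun l => minNormPoint_spec (K := ⋂ m, ⋂ (_ : m ≠ l), K m)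
    (isClosed_iInter fun m => isClosed_iInter fun _ => hcl m) ⟨x, hx' l⟩
  have key : ∃ l, ‖x‖ ≤ ‖minNormPoint (⋂ m, ⋂ (_ : m ≠ l), K m)‖ := by
    by_contra! hlt
    let H : Option (Fin (Module.finrank ℝ V + 1)) → Set V := fun o =>
      o.elim (Metric.ball 0 ‖x‖) K
    have hH : (⋂ i ∈ (Finset.univ : Finset (Option (Fin (Module.finrank ℝ V + 1)))),
        H i).Nonempty := by
      refine Convex.helly_theorem (𝕜 := ℝ) (by simp) ?_ ?_
      · rintro (_ | l) -
        · exact convex_ball _ _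
        · exact hconv l
      · intro I _ hI
        obtain ⟨o, ho⟩ : ∃ o, o ∉ I := by
          by_contra! hall
          rw [Finset.eq_univ_iff_forall.2 hall] at hI
          simp at hI
        rcases o with _ | l
        · refine ⟨x, ?_⟩
          simp only [Set.mem_iInter]
          rintro (_ | m) hm
          · exact absurd hm ho
          · exact hx m
        · refine ⟨minNormPoint (⋂ m, ⋂ (_ : m ≠ l), K m), ?_⟩
          simp only [Set.mem_iInter]
          rintro (_ | m) hm
          · simpa [H] using hlt l
          · have := (hspec l).1
            simp only [Set.mem_iInter] at this
            exact this m (by rintro rfl; exact ho hm)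
    obtain ⟨y, hy⟩ := hH
    simp only [Set.mem_iInter] at hy
    have h0 : ‖y‖ < ‖x‖ := by simpa [H] using hy none (Finset.mem_univ _)
    exact h0.not_ge (hxmin y (Set.mem_iInter.2 fun l => hy (some l) (Finset.mem_univ _)))
  obtain ⟨l, hl⟩ := key
  refine ⟨l, ?_⟩
  rw [← eq_minNormPoint (convex_iInter fun m => convex_iInter fun _ => hconv m) (hx' l)
    (fun y hy => hl.trans ((hspec l).2 y hy))]
  exact hx l

end MinNorm

section HeavyPoint

/-- Resampling the coordinates in `Q` preserves sums against a product weight. -/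
theorem sum_sum_prod_piecewise {A J : Type*} [Fintype A] [Fintype J] [DecidableEq J]
    (w : A → ℝ) (Φ : (J → A) → ℝ) (Q : Finset J) :
    ∑ g : J → A, ∑ h : J → A, (∏ j, w (g j)) * (∏ j, w (h j)) * Φ (Q.piecewise h g) =
      ∑ g : J → A, ∑ h : J → A, (∏ j, w (g j)) * (∏ j, w (h j)) * Φ g := by
  rw [← Fintype.sum_prod_type', ← Fintype.sum_prod_type']
  let e : ((J → A) × (J → A)) → ((J → A) × (J → A)) := fun x =>
    (Q.piecewise x.2 x.1, Q.piecewise x.1 x.2)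
  have he : Function.Involutive e := by
    rintro ⟨g, h⟩
    ext j <;> by_cases hj : j ∈ Q <;> simp [e, hj]
  refine Fintype.sum_equiv he.toPerm _ _ fun ⟨g, h⟩ => ?_
  simp only [Function.Involutive.coe_toPerm, e]
  congr 1
  rw [← Finset.prod_mul_distrib, ← Finset.prod_mul_distrib]
  refine Finset.prod_congr rfl fun j _ => ?_
  by_cases hj : j ∈ Q <;> simp [hj, mul_comm]

theorem sum_prod_comp_eq_pow {A : Type*} [Fintype A] (w : A → ℝ) (N : ℕ) :
    ∑ g : Fin N → A, ∏ j, w (g j) = (∑ a, w a) ^ N := by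
  rw [Fintype.sum_pow]

variable {V : Type*} [NormedAddCommGroup V] [InnerProductSpace ℝ V] [FiniteDimensional ℝ V]

open Classical in
/-- If every `N`-tuple carries `dim V + 1` intersecting closed convex sets depending on disjoint
blocks of coordinates, then some point lies in the set of a fixed block for a positive
proportion of all `N`-tuples. -/
theorem exists_heavy_point {A ι : Type*} [Fintype A] [Fintype ι] (N : ℕ) (w : A → ℝ)
    (hw : ∀ a, 0 ≤ w a) (hpos : 0 < ∑ a, w a)
    (K : ι → Finset (Fin N) → (Fin N → A) → Set V)
    (hcl : ∀ i Q g, IsClosed (K i Q g)) (hconv : ∀ i Q g, Convex ℝ (K i Q g))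
    (hdep : ∀ i Q g h, (∀ j ∈ Q, g j = h j) → K i Q g = K i Q h)
    (hint : ∀ g, ∃ i, ∃ Q : Fin (Module.finrank ℝ V + 1) → Finset (Fin N),
      Pairwise (fun l m => Disjoint (Q l) (Q m)) ∧ (∀ l, (Q l).Nonempty) ∧
      (⋂ l, K i (Q l) g).Nonempty) :
    ∃ i, ∃ Q : Finset (Fin N), Q.Nonempty ∧ ∃ z : V,
      (∑ a, w a) ^ N ≤ (Fintype.card
        (ι × (Fin (Module.finrank ℝ V + 1) → Finset (Fin N)) × Fin (Module.finrank ℝ V + 1))) *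
        ∑ h : Fin N → A, (∏ j, w (h j)) * if z ∈ K i Q h then 1 else 0 := by
  set B := ι × (Fin (Module.finrank ℝ V + 1) → Finset (Fin N)) × Fin (Module.finrank ℝ V + 1)
    with hB
  let x : B → (Fin N → A) → V := fun π g => minNormPoint (⋂ m, ⋂ (_ : m ≠ π.2.2), K π.1 (π.2.1 m) g)
  let E : B → (Fin N → A) → Prop := fun π g =>
    Pairwise (fun l m => Disjoint (π.2.1 l) (π.2.1 m)) ∧ (∀ l, (π.2.1 l).Nonempty) ∧
      x π g ∈ K π.1 (π.2.1 π.2.2) g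
  have hE : ∀ g, ∃ π, E π g := fun g => by
    obtain ⟨i, Q, hdis, hne, hi⟩ := hint g
    obtain ⟨l, hl⟩ := exists_minNormPoint_iInter_ne_mem (fun l => K i (Q l) g)
      (fun l => hcl _ _ _) (fun l => hconv _ _ _) hi
    exact ⟨(i, Q, l), hdis, hne, hl⟩
  set W := (∑ a, w a) ^ N with hW
  have hWpos : 0 < W := pow_pos hpos N
  have hw' : ∀ g : Fin N → A, 0 ≤ ∏ j, w (g j) := fun g => Finset.prod_nonneg fun j _ => hw _
  have hsumW : ∑ g : Fin N → A, ∏ j, w (g j) = W := sum_prod_comp_eq_pow w N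
  let T : B → ℝ := fun π => ∑ g : Fin N → A, (∏ j, w (g j)) * if E π g then 1 else 0
  have hWT : W ≤ ∑ π, T π := by
    simp only [T]
    rw [Finset.sum_comm, ← hsumW]
    refine Finset.sum_le_sum fun g _ => ?_
    rw [← Finset.mul_sum]
    refine le_mul_of_one_le_right (hw' g) ?_
    obtain ⟨π, hπ⟩ := hE g
    calc (1 : ℝ) = if E π g then 1 else 0 := by rw [if_pos hπ]
      _ ≤ _ := Finset.single_le_sum (f := fun π => if E π g then (1 : ℝ) else 0)
        (fun π _ => by split_ifs <;> norm_num) (Finset.mem_univ π)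
  obtain ⟨π, hπ⟩ : ∃ π, W ≤ Fintype.card B * T π := by
    by_contra! h
    have hBne : Nonempty B := by
      by_contra hemp
      rw [not_nonempty_iff] at hemp
      simp at hWT
      exact hWpos.not_ge hWT
    have : ∑ π : B, Fintype.card B * T π < ∑ _π : B, W :=
      Finset.sum_lt_sum_of_nonempty Finset.univ_nonempty fun π _ => h π
    rw [← Finset.mul_sum, Finset.sum_const, nsmul_eq_mul, Finset.card_univ] at this
    have hc : (0 : ℝ) < Fintype.card B := by exact_mod_cast Fintype.card_pos
    exact (lt_of_mul_lt_mul_left this hc.le).not_ge hWT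
  have hTpos : 0 < T π := by
    by_contra! h
    have : (Fintype.card B : ℝ) * T π ≤ 0 := mul_nonpos_of_nonneg_of_nonpos (by positivity) h
    linarith
  obtain ⟨g₀, hg₀⟩ : ∃ g₀, E π g₀ := by
    by_contra! h
    simp [T, h] at hTpos
  obtain ⟨hdis, hne, -⟩ := hg₀
  let S : V → ℝ := fun z =>
    ∑ h : Fin N → A, (∏ j, w (h j)) * if z ∈ K π.1 (π.2.1 π.2.2) h then 1 else 0
  have hdouble : T π * W = ∑ g : Fin N → A, (∏ j, w (g j)) * S (x π g) := by
    have h1 := sum_sum_prod_piecewise w (fun g => if E π g then (1 : ℝ) else 0) (π.2.1 π.2.2)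
    have h2 : ∑ g : Fin N → A, ∑ h : Fin N → A, (∏ j, w (g j)) * (∏ j, w (h j)) *
        (if E π g then (1 : ℝ) else 0) = T π * W := by
      rw [← hsumW, Finset.sum_mul_sum]
      refine Finset.sum_congr rfl fun g _ => Finset.sum_congr rfl fun h _ => by ring
    rw [← h2, ← h1]
    refine Finset.sum_congr rfl fun g _ => ?_
    simp only [S]
    rw [Finset.mul_sum]
    refine Finset.sum_congr rfl fun h _ => ?_
    rw [mul_assoc]
    congr 3
    have hK : K π.1 (π.2.1 π.2.2) ((π.2.1 π.2.2).piecewise h g) = K π.1 (π.2.1 π.2.2) h :=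
      hdep _ _ _ _ fun j hj => by simp [hj]
    have hx : x π ((π.2.1 π.2.2).piecewise h g) = x π g := by
      simp only [x]
      congr 1
      refine Set.iInter_congr fun m => Set.iInter_congr fun hm => hdep _ _ _ _ fun j hj => ?_
      rw [Finset.piecewise_eq_of_notMem]
      exact fun hj' => Finset.disjoint_left.1 (hdis hm) hj hj'
    simp only [E, hK, hx]
    simp [hdis, hne]
  obtain ⟨g, hg⟩ : ∃ g, T π ≤ S (x π g) := by
    by_contra! h
    obtain ⟨g₁, -, hg₁⟩ : ∃ g ∈ Finset.univ, 0 < ∏ j, w ((g : Fin N → A) j) := by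
      by_contra! hle
      exact hWpos.not_ge (hsumW ▸ Finset.sum_nonpos hle)
    have : ∑ g : Fin N → A, (∏ j, w (g j)) * S (x π g) < ∑ g : Fin N → A, (∏ j, w (g j)) * T π :=
      Finset.sum_lt_sum (fun g _ => mul_le_mul_of_nonneg_left (h g).le (hw' g))
        ⟨g₁, Finset.mem_univ _, mul_lt_mul_of_pos_left (h g₁) hg₁⟩
    rw [← Finset.sum_mul, hsumW, ← hdouble, mul_comm] at this
    exact lt_irrefl _ this
  refine ⟨π.1, π.2.1 π.2.2, hne _, x π g, hπ.trans ?_⟩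
  exact mul_le_mul_of_nonneg_left hg (by positivity)

end HeavyPoint

section Tverberg

variable {V : Type*} [AddCommGroup V] [Module ℝ V] [FiniteDimensional ℝ V]

/-- Centerpoints: some point lies in the convex hull of all but any `m` of the points. -/
theorem exists_centerpoint {N m : ℕ} (hN : (Module.finrank ℝ V + 1) * m < N) (g : Fin N → V) :
    ∃ z, ∀ S : Finset (Fin N), Sᶜ.card ≤ m → z ∈ convexHull ℝ (g '' S) := by
  classical
  obtain ⟨z, hz⟩ : (⋂ S ∈ (Finset.univ.filter fun S : Finset (Fin N) => Sᶜ.card ≤ m),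
      convexHull ℝ (g '' S)).Nonempty := by
    refine Convex.helly_theorem' (𝕜 := ℝ) (fun S _ => convex_convexHull _ _) fun I hI hIc => ?_
    obtain ⟨j, hj⟩ : ∃ j, j ∉ I.biUnion fun S => Sᶜ := by
      by_contra! h
      have h1 := Finset.card_biUnion_le_card_mul I (fun S => Sᶜ) m
        fun S hS => (Finset.mem_filter.1 (hI hS)).2
      rw [Finset.eq_univ_iff_forall.2 h, Finset.card_univ, Fintype.card_fin] at h1
      exact absurd (h1.trans (Nat.mul_le_mul_right m hIc)) hN.not_ge
    refine ⟨g j, ?_⟩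
    simp only [Finset.mem_biUnion, Finset.mem_compl, not_exists, not_and, not_not] at hj
    simp only [Set.mem_iInter]
    exact fun S hS => subset_convexHull _ _ ⟨j, hj S hS, rfl⟩
  simp only [Set.mem_iInter, Finset.mem_filter, Finset.mem_univ, true_and] at hz
  exact ⟨z, hz⟩

theorem exists_subset_image_eq_card_eq {J X : Type*} [DecidableEq J] [DecidableEq X] (g : J → X)
    {S : Finset J} {t : Finset X} (h : (t : Set X) ⊆ g '' S) :
    ∃ Q ⊆ S, Q.image g = t ∧ Q.card = t.card := by
  classical
  obtain ⟨Q, hQS, hbij⟩ := Set.SurjOn.exists_bijOn_subset (f := g) (s := (S : Set J))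
    (t := (t : Set X)) h
  refine ⟨S.filter (· ∈ Q), Finset.filter_subset _ _, ?_, ?_⟩
  · ext v
    simp only [Finset.mem_image, Finset.mem_filter]
    constructor
    · rintro ⟨j, ⟨-, hj⟩, rfl⟩
      exact hbij.mapsTo hj
    · intro hv
      obtain ⟨j, hj, rfl⟩ := hbij.surjOn hv
      exact ⟨j, ⟨hQS hj, hj⟩, rfl⟩
  · refine Finset.card_bij (fun j _ => g j) (fun j hj => ?_) (fun j hj k hk h => ?_) fun v hv => ?_
    · exact hbij.mapsTo (Finset.mem_filter.1 hj).2
    · exact hbij.injOn (Finset.mem_filter.1 hj).2 (Finset.mem_filter.1 hk).2 h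
    · obtain ⟨j, hj, rfl⟩ := hbij.surjOn hv
      exact ⟨j, Finset.mem_filter.2 ⟨hQS hj, hj⟩, rfl⟩

theorem exists_subset_card_le_mem_convexHull {J : Type*} [DecidableEq J] (g : J → V)
    (S : Finset J) {z : V} (hz : z ∈ convexHull ℝ (g '' S)) :
    ∃ Q ⊆ S, Q.card ≤ Module.finrank ℝ V + 1 ∧ z ∈ convexHull ℝ (g '' Q) := by
  classical
  rw [convexHull_eq_union] at hz
  simp only [Set.mem_iUnion] at hz
  obtain ⟨t, htS, hind, hzt⟩ := hz
  obtain ⟨Q, hQS, hQ⟩ := exists_subset_image_eq_card_eq g (S := S) (t := t) htS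
  refine ⟨Q, hQS, ?_, ?_⟩
  · rw [hQ.2]
    have := hind.card_le_finrank_succ
    rw [Fintype.card_coe] at this
    exact this.trans (Nat.succ_le_succ (Submodule.finrank_le _))
  · rw [← Finset.coe_image, hQ.1]
    exact hzt

/-- A weak form of Tverberg's theorem. -/
theorem exists_disjoint_blocks_convexHull (k : ℕ) {N : ℕ}
    (hN : (Module.finrank ℝ V + 1) * (k * (Module.finrank ℝ V + 1)) < N) (g : Fin N → V) :
    ∃ Q : Fin k → Finset (Fin N), Pairwise (fun l m => Disjoint (Q l) (Q m)) ∧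
      (∀ l, (Q l).Nonempty) ∧ (⋂ l, convexHull ℝ (g '' (Q l : Set (Fin N)))).Nonempty := by
  classical
  obtain ⟨z, hz⟩ := exists_centerpoint hN g
  have key : ∀ j ≤ k, ∃ Q : Fin j → Finset (Fin N),
      Pairwise (fun l m => Disjoint (Q l) (Q m)) ∧
      (∀ l, (Q l).card ≤ Module.finrank ℝ V + 1) ∧
      ∀ l, z ∈ convexHull ℝ (g '' (Q l : Set (Fin N))) := by
    intro j
    induction j with
    | zero => exact fun _ => ⟨Fin.elim0, fun l => l.elim0, fun l => l.elim0, fun l => l.elim0⟩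
    | succ j ih =>
      intro hj
      obtain ⟨Q, hdis, hcard, hmem⟩ := ih (by omega)
      have hU : (Finset.univ.biUnion Q).card ≤ k * (Module.finrank ℝ V + 1) := by
        refine (Finset.card_biUnion_le_card_mul _ _ _ fun l _ => hcard l).trans ?_
        rw [Finset.card_univ, Fintype.card_fin]
        exact Nat.mul_le_mul_right _ (by omega)
      obtain ⟨R, hR, hRc, hRz⟩ := exists_subset_card_le_mem_convexHull g _
        (hz (Finset.univ.biUnion Q)ᶜ (by rwa [compl_compl]))
      have hRQ : ∀ l, Disjoint R (Q l) := fun l => Finset.disjoint_left.2 fun a ha haQ =>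
        Finset.mem_compl.1 (hR ha) (Finset.mem_biUnion.2 ⟨l, Finset.mem_univ _, haQ⟩)
      refine ⟨Fin.cons R Q, ?_, ?_, ?_⟩
      · intro l m hlm
        cases l using Fin.cases with
        | zero =>
          cases m using Fin.cases with
          | zero => exact absurd rfl hlm
          | succ m => simpa using hRQ m
        | succ l =>
          cases m using Fin.cases with
          | zero => simpa using (hRQ l).symm
          | succ m => simpa using hdis (fun h => hlm (congrArg _ h))
      · intro l
        cases l using Fin.cases with
        | zero => simpa using hRc
        | succ l => simpa using hcard l
      · intro l
        cases l using Fin.cases with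
        | zero => simpa using hRz
        | succ l => simpa using hmem l
  obtain ⟨Q, hdis, -, hmem⟩ := key k le_rfl
  refine ⟨Q, hdis, fun l => ?_, z, Set.mem_iInter.2 hmem⟩
  have := convexHull_nonempty_iff.1 ⟨z, hmem l⟩
  simpa using this

end Tverberg

section Duality

open Classical in
/-- Linear programming duality for transversals: if every weighting of the sets has a point in a
proportion `β` of them, then some weighting of points gives every set mass at least `β`. -/
theorem exists_dual_weights {A V : Type} [Fintype A] [Nonempty A] (S : A → Set V) (β : ℝ)
    (h : ∀ w : A → ℝ, (∀ a, 0 ≤ w a) → ∑ a, w a = 1 →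
      ∃ z, β ≤ ∑ a, w a * if z ∈ S a then 1 else 0) :
    ∃ (X : Type) (_ : Fintype X) (pt : X → V) (u : X → ℝ), (∀ x, 0 ≤ u x) ∧ ∑ x, u x = 1 ∧
      ∀ a, β ≤ ∑ x, u x * if pt x ∈ S a then 1 else 0 := by
  let vec : V → (A → ℝ) := fun z a => if z ∈ S a then 1 else 0
  have hfin : (Set.range vec).Finite := by
    refine (Set.Finite.pi' (t := fun _ : A => ({0, 1} : Set ℝ)) fun a => by simp).subset ?_
    rintro _ ⟨z, rfl⟩ a
    simp only [vec]
    split_ifs <;> simp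
  let D : Set (A → ℝ) := {y | ∀ a, β ≤ y a}
  have hDconv : Convex ℝ D := by
    have : D = ⋂ a, {y : A → ℝ | β ≤ y a} := by ext; simp [D]
    rw [this]
    exact convex_iInter fun a => convex_halfSpace_ge
      (LinearMap.proj (R := ℝ) (φ := fun _ : A => ℝ) a).isLinear β
  have hDcl : IsClosed D := by
    have : D = ⋂ a, {y : A → ℝ | β ≤ y a} := by ext; simp [D]
    rw [this]
    exact isClosed_iInter fun a => isClosed_le continuous_const (continuous_apply a)
  by_cases hdisj : Disjoint (convexHull ℝ (Set.range vec)) D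
  · exfalso
    obtain ⟨f, s, t, hs, hst, ht⟩ := geometric_hahn_banach_compact_closed
      (convex_convexHull ℝ _) (hfin.isCompact_convexHull ℝ) hDconv hDcl hdisj
    let c : A → ℝ := fun a => f (Pi.single a 1)
    have hf : ∀ y : A → ℝ, f y = ∑ a, c a * y a := fun y => by
      conv_lhs => rw [pi_eq_sum_univ' y]
      rw [map_sum]
      refine Finset.sum_congr rfl fun a _ => ?_
      rw [map_smul, smul_eq_mul, mul_comm]
    have hc : ∀ a, 0 ≤ c a := fun a => by
      by_contra! hlt
      have h0 := ht (fun _ => β) fun _ => le_rfl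
      set τ := (f (fun _ => β) - t) / (-c a) with hτ
      have hτ0 : 0 ≤ τ := div_nonneg (by linarith) (by linarith)
      have h1 := ht ((fun _ => β) + τ • Pi.single a 1) fun b => by
        simp only [Pi.add_apply, Pi.smul_apply, smul_eq_mul, Pi.single_apply]
        split_ifs <;> simp [hτ0]
      rw [map_add, map_smul, smul_eq_mul] at h1
      have h2 : τ * f (Pi.single a 1) = -(f (fun _ => β) - t) := by
        change τ * c a = _
        rw [hτ]
        field_simp [hlt.ne]
      linarith
    have hlt : ∀ z, ∑ a, c a * vec z a < ∑ a, c a * β := fun z => by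
      have h1 := hs _ (subset_convexHull ℝ _ ⟨z, rfl⟩)
      have h2 := ht (fun _ => β) fun _ => le_rfl
      rw [hf] at h1 h2
      linarith
    obtain hzero | hpos := (Finset.sum_nonneg fun a (_ : a ∈ Finset.univ) => hc a).eq_or_lt
    · have hc0 : ∀ a, c a = 0 := fun a =>
        (Finset.sum_eq_zero_iff_of_nonneg fun a _ => hc a).1 hzero.symm a (Finset.mem_univ a)
      obtain ⟨z, -⟩ := h (fun _ => 1 / Fintype.card A) (fun _ => by positivity) (by simp)
      simpa [hc0] using hlt z
    · obtain ⟨z, hz⟩ := h (fun a => c a / ∑ b, c b) (fun a => div_nonneg (hc a) hpos.le)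
        (by rw [← Finset.sum_div, div_self hpos.ne'])
      have h1 : ∑ a, c a / (∑ b, c b) * (if z ∈ S a then 1 else 0) =
          (∑ a, c a * vec z a) / ∑ b, c b := by
        rw [Finset.sum_div]
        exact Finset.sum_congr rfl fun a _ => by rw [div_mul_eq_mul_div]
      rw [h1, le_div_iff₀ hpos] at hz
      have h2 := hlt z
      rw [← Finset.sum_mul] at h2
      linarith
  · obtain ⟨y, hy, hyD⟩ := Set.not_disjoint_iff.1 hdisj
    rw [← hfin.coe_toFinset, Finset.mem_convexHull'] at hy
    obtain ⟨u, hu, husum, huy⟩ := hy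
    have hpt : ∀ x : hfin.toFinset, ∃ z, vec z = x := fun x => by
      simpa using hfin.mem_toFinset.1 x.2
    choose pt hpt using hpt
    refine ⟨hfin.toFinset, inferInstance, pt, fun x => u x, fun x => hu _ x.2, ?_, fun a => ?_⟩
    · rw [← husum]
      exact Finset.sum_coe_sort hfin.toFinset u
    · have h1 := hyD a
      rw [← huy, Finset.sum_apply, ← Finset.sum_coe_sort] at h1
      refine h1.trans_eq (Finset.sum_congr rfl fun x _ => ?_)
      change u x * (x : A → ℝ) a = u x * vec (pt x) a
      rw [hpt x]

end Duality

section Piercing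

variable (V : Type) [NormedAddCommGroup V] [InnerProductSpace ℝ V] [FiniteDimensional ℝ V]

open Classical in
/-- Weak `ε`-nets for convex sets. -/
theorem exists_weak_net {ε : ℝ} (hε : 0 < ε) :
    ∃ r : ℕ, ∀ (X : Type) [Fintype X] (pt : X → V) (u : X → ℝ), (∀ x, 0 ≤ u x) → ∑ x, u x = 1 →
      ∃ Z : Finset V, Z.card ≤ r ∧ ∀ C : Set V, Convex ℝ C →
        ε ≤ ∑ x, u x * (if pt x ∈ C then 1 else 0) → ∃ z ∈ Z, z ∈ C := by
  obtain ⟨N, hN⟩ : ∃ N, (Module.finrank ℝ V + 1) *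
    ((Module.finrank ℝ V + 1) * (Module.finrank ℝ V + 1)) < N := ⟨_, Nat.lt_succ_self _⟩
  set B : ℝ := (Fintype.card (Unit × (Fin (Module.finrank ℝ V + 1) → Finset (Fin N)) ×
    Fin (Module.finrank ℝ V + 1)) : ℝ) with hB
  have hBpos : 0 < B := by
    rw [hB]
    exact_mod_cast Fintype.card_pos
  set δ := ε ^ N / B with hδ
  have hδpos : 0 < δ := by positivity
  obtain ⟨r, hr⟩ := exists_nat_gt (1 / δ)
  refine ⟨r, fun X _ pt u hu husum => ?_⟩
  let H : (Fin N → X) → Set V := fun h => convexHull ℝ (Set.range fun j => pt (h j))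
  let U : Finset V → ℝ := fun Z =>
    ∑ h : Fin N → X, (∏ j, u (h j)) * if ∃ z ∈ Z, z ∈ H h then 0 else 1
  have hprod : ∀ h : Fin N → X, 0 ≤ ∏ j, u (h j) := fun h => Finset.prod_nonneg fun j _ => hu _
  have hU0 : ∀ Z, 0 ≤ U Z := fun Z => Finset.sum_nonneg fun h _ =>
    mul_nonneg (hprod h) (by split_ifs <;> norm_num)
  have step : ∀ Z : Finset V, ∀ C : Set V, Convex ℝ C →
      ε ≤ ∑ x, u x * (if pt x ∈ C then 1 else 0) → (¬ ∃ z ∈ Z, z ∈ C) →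
      ∃ z, U (insert z Z) + δ ≤ U Z := by
    intro Z C hC hmass hZ
    set w : X → ℝ := fun x => u x * if pt x ∈ C then 1 else 0 with hw
    have hw0 : ∀ x, 0 ≤ w x := fun x => mul_nonneg (hu x) (by split_ifs <;> norm_num)
    obtain ⟨-, Q, -, z, hz⟩ := exists_heavy_point (V := V) (ι := Unit) N w hw0
      (hε.trans_le hmass) (fun _ Q g => convexHull ℝ ((fun j => pt (g j)) '' (Q : Set (Fin N))))
      (fun _ Q g => ((Q.finite_toSet.image _).isCompact_convexHull ℝ).isClosed)
      (fun _ Q g => convex_convexHull _ _)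
      (fun _ Q g h hgh => by
        congr 1
        exact Set.image_congr fun j hj => by rw [hgh j hj])
      (fun g => ⟨(), exists_disjoint_blocks_convexHull _ hN fun j => pt (g j)⟩)
    refine ⟨z, ?_⟩
    have h1 : δ ≤ ∑ h : Fin N → X, (∏ j, w (h j)) *
        if z ∈ convexHull ℝ ((fun j => pt (h j)) '' (Q : Set (Fin N))) then 1 else 0 := by
      rw [hδ, div_le_iff₀' hBpos]
      exact (pow_le_pow_left₀ hε.le hmass N).trans hz
    refine (add_le_add_right h1 _).trans ?_
    simp only [U]
    rw [← Finset.sum_add_distrib]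
    refine Finset.sum_le_sum fun h _ => ?_
    by_cases hall : ∀ j, pt (h j) ∈ C
    · have hwu : ∏ j, w (h j) = ∏ j, u (h j) :=
        Finset.prod_congr rfl fun j _ => by simp [hw, hall j]
      have hHC : H h ⊆ C := convexHull_min (by rintro _ ⟨j, rfl⟩; exact hall j) hC
      have hnot : ¬ ∃ z ∈ Z, z ∈ H h := fun ⟨z, hz, hzH⟩ => hZ ⟨z, hz, hHC hzH⟩
      rw [hwu, if_neg hnot, ← mul_add]
      refine mul_le_mul_of_nonneg_left ?_ (hprod h)
      by_cases hzQ : z ∈ convexHull ℝ ((fun j => pt (h j)) '' (Q : Set (Fin N)))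
      · have hzH : z ∈ H h := convexHull_mono (Set.image_subset_range _ _) hzQ
        rw [if_pos hzQ, if_pos ⟨z, Finset.mem_insert_self _ _, hzH⟩]
        norm_num
      · rw [if_neg hzQ]
        split_ifs <;> norm_num
    · push Not at hall
      obtain ⟨j, hj⟩ := hall
      have hw0' : ∏ j, w (h j) = 0 := Finset.prod_eq_zero (Finset.mem_univ j) (by simp [hw, hj])
      rw [hw0', zero_mul, add_zero]
      refine mul_le_mul_of_nonneg_left ?_ (hprod h)
      by_cases hZh : ∃ z ∈ Z, z ∈ H h
      · obtain ⟨z', hz', hz'H⟩ := hZh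
        rw [if_pos ⟨z', Finset.mem_insert_of_mem hz', hz'H⟩, if_pos ⟨z', hz', hz'H⟩]
      · rw [if_neg hZh]
        split_ifs <;> norm_num
  have greedy : ∀ k : ℕ, ∃ Z : Finset V, Z.card ≤ k ∧ ((∀ C : Set V, Convex ℝ C →
      ε ≤ ∑ x, u x * (if pt x ∈ C then 1 else 0) → ∃ z ∈ Z, z ∈ C) ∨ U Z + k * δ ≤ 1) := by
    intro k
    induction k with
    | zero =>
      refine ⟨∅, le_rfl, Or.inr ?_⟩
      simp [U, sum_prod_comp_eq_pow, husum]
    | succ k ih =>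
      obtain ⟨Z, hZc, hZ⟩ := ih
      by_cases hnet : ∀ C : Set V, Convex ℝ C →
          ε ≤ ∑ x, u x * (if pt x ∈ C then 1 else 0) → ∃ z ∈ Z, z ∈ C
      · exact ⟨Z, hZc.trans (Nat.le_succ k), Or.inl hnet⟩
      · have hZ' := hZ.resolve_left hnet
        push Not at hnet
        obtain ⟨C, hC, hmass, hCZ⟩ := hnet
        obtain ⟨z, hz⟩ := step Z C hC hmass (fun ⟨z, h1, h2⟩ => hCZ z h1 h2)
        refine ⟨insert z Z, (Finset.card_insert_le _ _).trans (Nat.succ_le_succ hZc), Or.inr ?_⟩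
        push_cast
        linarith
  obtain ⟨Z, hZc, hZ⟩ := greedy r
  refine ⟨Z, hZc, hZ.resolve_right fun hle => ?_⟩
  rw [div_lt_iff₀ hδpos] at hr
  linarith [hU0 Z]

variable {V}

theorem sum_prod_mul_apply {A J : Type*} [Fintype A] [Fintype J] [DecidableEq J] (w φ : A → ℝ)
    (hw : ∑ a, w a = 1) (l : J) :
    ∑ h : J → A, (∏ j, w (h j)) * φ (h l) = ∑ a, w a * φ a := by
  have h := Finset.prod_univ_sum (fun _ : J => (Finset.univ : Finset A))
    (fun j a => if j = l then w a * φ a else w a)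
  rw [Fintype.piFinset_univ] at h
  have h1 : ∏ j, ∑ a, (if j = l then w a * φ a else w a) = ∑ a, w a * φ a := by
    rw [← Finset.mul_prod_erase _ _ (Finset.mem_univ l), Finset.prod_eq_one]
    · simp
    · intro j hj
      simp [Finset.ne_of_mem_erase hj, hw]
  rw [← h1, h]
  refine Finset.sum_congr rfl fun g _ => ?_
  rw [← Finset.mul_prod_erase _ _ (Finset.mem_univ l),
    ← Finset.mul_prod_erase _ (fun j => if j = l then w (g j) * φ (g j) else w (g j))
      (Finset.mem_univ l)]
  have h2 : ∏ j ∈ Finset.univ.erase l, (if j = l then w (g j) * φ (g j) else w (g j)) =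
      ∏ j ∈ Finset.univ.erase l, w (g j) :=
    Finset.prod_congr rfl fun j hj => by simp [Finset.ne_of_mem_erase hj]
  rw [h2, if_pos rfl]
  ring

open Classical in
/-- Weighted fractional Helly conclusion from intersecting subfamilies of `N`-tuples. -/
theorem exists_point_of_intersecting_tuples {A ι : Type} [Fintype A] [Fintype ι] (N : ℕ)
    (w : A → ℝ) (hw : ∀ a, 0 ≤ w a) (hsum : ∑ a, w a = 1) (G : ι → A → Set V)
    (hG : ∀ i a, Convex ℝ (G i a))
    (hint : ∀ g : Fin N → A, ∃ i, ∃ Q : Finset (Fin N), Q.card = Module.finrank ℝ V + 1 ∧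
      ∃ z, ∀ j ∈ Q, z ∈ G i (g j)) :
    ∃ i z, 1 ≤ (Fintype.card
        (ι × (Fin (Module.finrank ℝ V + 1) → Finset (Fin N)) × Fin (Module.finrank ℝ V + 1))) *
      ∑ a, w a * if z ∈ G i a then 1 else 0 := by
  have hchoice : ∀ i (R : Finset A), ∃ z, (∃ z, ∀ a ∈ R, z ∈ G i a) → ∀ a ∈ R, z ∈ G i a :=
    fun i R => by
      by_cases h : ∃ z, ∀ a ∈ R, z ∈ G i a
      · exact ⟨h.choose, fun _ => h.choose_spec⟩
      · exact ⟨0, fun h' => absurd h' h⟩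
  choose c hc using hchoice
  let G' : ι → A → Set V := fun i a =>
    convexHull ℝ (c i '' {R | a ∈ R ∧ ∃ z, ∀ a ∈ R, z ∈ G i a})
  have hG'G : ∀ i a, G' i a ⊆ G i a := fun i a => convexHull_min (by
    rintro _ ⟨R, ⟨haR, hR⟩, rfl⟩
    exact hc i R hR a haR) (hG i a)
  let K : ι → Finset (Fin N) → (Fin N → A) → Set V := fun i Q g => ⋂ j ∈ Q, G' i (g j)
  obtain ⟨i, Q, ⟨l, hl⟩, z, hz⟩ := exists_heavy_point (V := V) N w hw (by rw [hsum]; norm_num) K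
    (fun i Q g => isClosed_biInter fun j _ => ((Set.toFinite _).isCompact_convexHull ℝ).isClosed)
    (fun i Q g => convex_iInter₂ fun j _ => convex_convexHull _ _)
    (fun i Q g h hgh => Set.iInter₂_congr fun j hj => by rw [hgh j hj])
    (fun g => by
      obtain ⟨i, Q, hQ, z, hz⟩ := hint g
      let e := Q.orderEmbOfFin hQ
      refine ⟨i, fun l => {e l}, fun l m hlm => ?_, fun l => by simp,
        c i (Q.image g), ?_⟩
      · simpa using hlm
      · refine Set.mem_iInter.2 fun l => ?_
        simp only [K, Finset.mem_singleton, Set.iInter_iInter_eq_left]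
        refine subset_convexHull _ _ ⟨Q.image g, ⟨Finset.mem_image_of_mem _ ?_, z, ?_⟩, rfl⟩
        · exact Q.orderEmbOfFin_mem hQ l
        · simpa using hz)
  refine ⟨i, z, ?_⟩
  rw [hsum, one_pow] at hz
  refine hz.trans (mul_le_mul_of_nonneg_left ?_ (by positivity))
  rw [← sum_prod_mul_apply w (fun a => if z ∈ G i a then (1 : ℝ) else 0) hsum l]
  refine Finset.sum_le_sum fun h _ =>
    mul_le_mul_of_nonneg_left ?_ (Finset.prod_nonneg fun j _ => hw _)
  by_cases hzK : z ∈ K i Q h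
  · rw [if_pos hzK, if_pos (hG'G _ _ (Set.mem_iInter₂.1 hzK l hl))]
  · rw [if_neg hzK]
    split_ifs <;> norm_num

open Classical in
/-- A `(p, q)`-theorem for families whose members are unions of boundedly many convex sets. -/
theorem exists_bounded_transversal (V : Type) [NormedAddCommGroup V] [InnerProductSpace ℝ V]
    [FiniteDimensional ℝ V] (ι : Type) [Fintype ι] (N : ℕ) :
    ∃ r : ℕ, ∀ (A : Type) [Fintype A] (G : ι → A → Set V), (∀ i a, Convex ℝ (G i a)) →
      (∀ g : Fin N → A, ∃ i, ∃ Q : Finset (Fin N), Q.card = Module.finrank ℝ V + 1 ∧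
        ∃ z, ∀ j ∈ Q, z ∈ G i (g j)) →
      ∃ Z : Finset V, Z.card ≤ r ∧ ∀ a, ∃ i, ∃ z ∈ Z, z ∈ G i a := by
  cases isEmpty_or_nonempty ι with
  | inl hι =>
    refine ⟨0, fun A _ G _ hint => ⟨∅, le_rfl, fun a => ?_⟩⟩
    exact isEmptyElim (hint fun _ => a).choose
  | inr hι =>
    set B : ℝ := (Fintype.card (ι × (Fin (Module.finrank ℝ V + 1) → Finset (Fin N)) ×
      Fin (Module.finrank ℝ V + 1)) : ℝ) with hB
    have hBpos : 0 < B := by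
      rw [hB]
      exact_mod_cast Fintype.card_pos
    have hιpos : (0 : ℝ) < Fintype.card ι := by exact_mod_cast Fintype.card_pos
    obtain ⟨r, hr⟩ := exists_weak_net V (ε := 1 / B / Fintype.card ι) (by positivity)
    refine ⟨r, fun A _ G hG hint => ?_⟩
    cases isEmpty_or_nonempty A with
    | inl hA => exact ⟨∅, Nat.zero_le _, fun a => isEmptyElim a⟩
    | inr hA =>
      obtain ⟨X, _, pt, u, hu, husum, hdual⟩ := exists_dual_weights (fun a => ⋃ i, G i a) (1 / B)
        fun w hw hsum => by
          obtain ⟨i, z, hz⟩ := exists_point_of_intersecting_tuples N w hw hsum G hG hint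
          refine ⟨z, ?_⟩
          rw [div_le_iff₀' hBpos]
          refine hz.trans (mul_le_mul_of_nonneg_left (Finset.sum_le_sum fun a _ =>
            mul_le_mul_of_nonneg_left ?_ (hw a)) hBpos.le)
          by_cases hza : z ∈ G i a
          · rw [if_pos hza, if_pos (Set.mem_iUnion.2 ⟨i, hza⟩)]
          · rw [if_neg hza]
            split_ifs <;> norm_num
      obtain ⟨Z, hZc, hZ⟩ := hr X pt u hu husum
      refine ⟨Z, hZc, fun a => ?_⟩
      obtain ⟨i, hi⟩ : ∃ i, 1 / B / Fintype.card ι ≤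
          ∑ x, u x * (if pt x ∈ G i a then 1 else 0) := by
        by_contra! hlt
        have h1 : ∑ i, ∑ x, u x * (if pt x ∈ G i a then (1 : ℝ) else 0) <
            ∑ _i : ι, 1 / B / Fintype.card ι :=
          Finset.sum_lt_sum_of_nonempty Finset.univ_nonempty fun i _ => hlt i
        rw [Finset.sum_const, Finset.card_univ, nsmul_eq_mul, mul_div_cancel₀ _ hιpos.ne',
          Finset.sum_comm] at h1
        refine h1.not_ge ((hdual a).trans (Finset.sum_le_sum fun x _ => ?_))
        rw [← Finset.mul_sum]
        refine mul_le_mul_of_nonneg_left ?_ (hu x)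
        split_ifs with hx
        · obtain ⟨i, hi⟩ := Set.mem_iUnion.1 hx
          calc (1 : ℝ) = if pt x ∈ G i a then 1 else 0 := by rw [if_pos hi]
            _ ≤ _ := Finset.single_le_sum (f := fun i => if pt x ∈ G i a then (1 : ℝ) else 0)
              (fun i _ => by split_ifs <;> norm_num) (Finset.mem_univ i)
        · exact Finset.sum_nonneg fun i _ => by split_ifs <;> norm_num
      exact ⟨i, hZ _ (hG i a) hi⟩

end Piercing

section Diameter

/-- A convex set of diameter at least `1` containing `x` contains a point whose `i`-th coordinate
differs from that of `x` by exactly `1 / (4 * d)`, for some `i`. -/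
theorem exists_coordinate_displacement {d : ℕ} (hd : 0 < d) {s : Set (EuclideanSpace ℝ (Fin d))}
    (hs : Convex ℝ s) (hdiam : 1 ≤ Metric.ediam s) {x : EuclideanSpace ℝ (Fin d)} (hx : x ∈ s) :
    ∃ k : Fin d × Bool, ∃ y ∈ s, y k.1 - x k.1 = (if k.2 then 1 else -1) * (1 / (4 * d)) := by
  have hd' : (0 : ℝ) < d := by exact_mod_cast hd
  obtain ⟨y, hy, hxy⟩ : ∃ y ∈ s, 1 / 4 < ‖y - x‖ := by
    by_contra! hle
    have h : Metric.ediam s ≤ ENNReal.ofReal (1 / 2) := Metric.ediam_le fun u hu v hv => by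
      rw [edist_dist]
      refine ENNReal.ofReal_le_ofReal ?_
      have h1 := dist_triangle_right u v x
      rw [dist_eq_norm u x, dist_eq_norm v x] at h1
      linarith [hle u hu, hle v hv]
    have h2 := hdiam.trans h
    rw [← ENNReal.ofReal_one, ENNReal.ofReal_le_ofReal_iff (by norm_num)] at h2
    norm_num at h2
  obtain ⟨i, hi⟩ : ∃ i, 1 / (4 * d) ≤ |y i - x i| := by
    by_contra! hlt
    have hsum : ‖y - x‖ ≤ ∑ i : Fin d, |y i - x i| := by
      conv_lhs => rw [← (EuclideanSpace.basisFun (Fin d) ℝ).sum_repr (y - x)]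
      refine (norm_sum_le _ _).trans (Finset.sum_le_sum fun i _ => ?_)
      rw [norm_smul]
      simp
    have h1 : ∑ i : Fin d, |y i - x i| ≤ ∑ _i : Fin d, 1 / (4 * d : ℝ) :=
      Finset.sum_le_sum fun i _ => (hlt i).le
    rw [Finset.sum_const, Finset.card_univ, Fintype.card_fin, nsmul_eq_mul] at h1
    have h2 : (d : ℝ) * (1 / (4 * d)) = 1 / 4 := by field_simp
    linarith
  have hc : (0 : ℝ) < 1 / (4 * d) := by positivity
  have hpos : 0 < |y i - x i| := hc.trans_le hi
  set τ : ℝ := 1 / (4 * d) / |y i - x i| with hτ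
  have hτ0 : 0 ≤ τ := by positivity
  have hτ1 : τ ≤ 1 := (div_le_one hpos).2 hi
  have hmul : τ * |y i - x i| = 1 / (4 * d) := div_mul_cancel₀ _ hpos.ne'
  have hmem : x + τ • (y - x) ∈ s := hs.add_smul_sub_mem hx hy ⟨hτ0, hτ1⟩
  refine ⟨(i, decide (0 ≤ y i - x i)), x + τ • (y - x), hmem, ?_⟩
  have hcoord : (x + τ • (y - x)) i - x i = τ * (y i - x i) := by simp
  simp only [hcoord]
  rcases le_or_gt 0 (y i - x i) with h | h
  · rw [abs_of_nonneg h] at hmul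
    simp only [h, decide_true, if_true, one_mul]
    exact hmul
  · rw [abs_of_neg h] at hmul
    simp only [h.not_ge, decide_false, Bool.false_eq_true, if_false]
    linarith

/-- Every sufficiently long sequence from a family with the `(p, d + 1)`-property for diameter
contains a subsequence of length `m` whose members share two separated points. -/
theorem exists_common_separated_pair {d : ℕ} (hd : 0 < d) (p m : ℕ) (hm : d + 1 ≤ m) :
    ∃ N : ℕ, ∀ F : Finset (Set (EuclideanSpace ℝ (Fin d))),
      (∀ C ∈ F, Convex ℝ C ∧ 1 ≤ Metric.ediam C) →
      (∀ P ⊆ F, P.card = p → ∃ Q ⊆ P, Q.card = d + 1 ∧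
        1 ≤ Metric.ediam (⋂₀ (Q : Set (Set (EuclideanSpace ℝ (Fin d)))))) →
      ∀ g : Fin N → Set (EuclideanSpace ℝ (Fin d)), (∀ j, g j ∈ F) →
      ∃ i : Fin d, ∃ Q : Finset (Fin N), Q.card = m ∧ ∃ x y : EuclideanSpace ℝ (Fin d),
        y i - x i = 1 / (4 * d) ∧ ∀ j ∈ Q, x ∈ g j ∧ y ∈ g j := by
  classical
  obtain ⟨N₂, hN₂⟩ := exists_monochromatic_subset (Fin d × Bool) (d + 1) m
  obtain ⟨N, hN⟩ := exists_monochromatic_subset Bool (d + 1) (N₂ + (d + 1) + p * (d + 1))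
  refine ⟨N, fun F hF hpq g hg => ?_⟩
  obtain ⟨M, -, hMc, c, hc⟩ := hN (Fin N) Finset.univ (by simp)
    fun Q => decide (1 ≤ Metric.ediam (⋂ j ∈ Q, g j))
  have hgood : ∀ Q ⊆ M, Q.card = d + 1 → 1 ≤ Metric.ediam (⋂ j ∈ Q, g j) := by
    have hex : ∃ Q ⊆ M, Q.card = d + 1 ∧ 1 ≤ Metric.ediam (⋂ j ∈ Q, g j) := by
      by_cases himg : p ≤ (M.image g).card
      · obtain ⟨P, hP, hPc⟩ := Finset.exists_subset_card_eq himg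
        obtain ⟨Q, hQP, hQc, hQd⟩ := hpq P (fun C hC => by
          obtain ⟨j, -, rfl⟩ := Finset.mem_image.1 (hP hC)
          exact hg j) hPc
        obtain ⟨R, hRM, hRQ, hRc⟩ := exists_subset_image_eq_card_eq g (S := M) (t := Q)
          (by rw [← Finset.coe_image]; exact_mod_cast hQP.trans hP)
        refine ⟨R, hRM, hRc.trans hQc, ?_⟩
        rwa [← hRQ, Finset.coe_image, Set.sInter_image] at hQd
      · obtain ⟨C, hC, hfib⟩ := Finset.exists_lt_card_fiber_of_mul_lt_card_of_maps_to
          (s := M) (t := M.image g) (f := g) (n := d) (fun j hj => Finset.mem_image_of_mem _ hj)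
          (by
            have : (M.image g).card * d ≤ p * d := Nat.mul_le_mul_right _ (by omega)
            rw [hMc]
            nlinarith)
        obtain ⟨R, hR, hRc⟩ := Finset.exists_subset_card_eq (Nat.succ_le_of_lt hfib)
        have hRC : ∀ j ∈ R, g j = C := fun j hj => (Finset.mem_filter.1 (hR hj)).2
        refine ⟨R, fun j hj => (Finset.mem_filter.1 (hR hj)).1, hRc, ?_⟩
        obtain ⟨j₀, hj₀⟩ : R.Nonempty := Finset.card_pos.1 (by omega)
        have hI : (⋂ j ∈ R, g j) = C := by
          rw [Set.iInter₂_congr hRC]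
          exact Set.biInter_const ⟨j₀, hj₀⟩ C
        rw [hI, ← hRC j₀ hj₀]
        exact (hF _ (hg j₀)).2
    obtain ⟨Q₀, hQ₀, hQ₀c, hQ₀d⟩ := hex
    have hct : c = true := by rw [← hc Q₀ hQ₀ hQ₀c]; simpa using hQ₀d
    intro Q hQ hQc
    simpa [hct] using hc Q hQ hQc
  have hfr : Module.finrank ℝ (EuclideanSpace ℝ (Fin d)) = d := finrank_euclideanSpace_fin
  obtain ⟨x, hx⟩ : (⋂ j ∈ M, g j).Nonempty := by
    refine Convex.helly_theorem (𝕜 := ℝ) (by rw [hfr, hMc]; omega) (fun j _ => (hF _ (hg j)).1)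
      fun I hI hIc => ?_
    rw [hfr] at hIc
    by_contra hemp
    have h := hgood I hI hIc
    rw [Set.not_nonempty_iff_eq_empty.1 hemp] at h
    exact absurd (h.trans_eq Metric.ediam_empty) (by simp)
  rw [Set.mem_iInter₂] at hx
  have hcol : ∀ Q : Finset (Fin N), ∃ k : Fin d × Bool, (Q ⊆ M → Q.card = d + 1 →
      ∃ y ∈ ⋂ j ∈ Q, g j, y k.1 - x k.1 = (if k.2 then 1 else -1) * (1 / (4 * d))) := fun Q => by
    by_cases hQ : Q ⊆ M ∧ Q.card = d + 1
    · obtain ⟨k, hk⟩ := exists_coordinate_displacement hd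
        (convex_iInter₂ fun j _ => (hF _ (hg j)).1) (hgood Q hQ.1 hQ.2)
        (Set.mem_iInter₂.2 fun j hj => hx j (hQ.1 hj))
      exact ⟨k, fun _ _ => hk⟩
    · exact ⟨(⟨0, hd⟩, true), fun h1 h2 => absurd ⟨h1, h2⟩ hQ⟩
  choose χ hχ using hcol
  obtain ⟨M', hM', hM'c, k, hk⟩ := hN₂ (Fin N) M (by omega) χ
  let H : Set (EuclideanSpace ℝ (Fin d)) :=
    {y | y k.1 - x k.1 = (if k.2 then 1 else -1) * (1 / (4 * d))}
  have hH : Convex ℝ H := by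
    intro y hy z hz a b _ _ hab
    change (a • y + b • z) k.1 - x k.1 = _
    rw [← one_mul (x k.1), ← hab, PiLp.add_apply, PiLp.smul_apply, PiLp.smul_apply, smul_eq_mul,
      smul_eq_mul]
    calc a * y k.1 + b * z k.1 - (a + b) * x k.1
        = a * (y k.1 - x k.1) + b * (z k.1 - x k.1) := by ring
      _ = _ := by rw [hy, hz, ← add_mul, hab, one_mul]
  obtain ⟨y, hy⟩ : (⋂ j ∈ M', g j ∩ H).Nonempty := by
    refine Convex.helly_theorem (𝕜 := ℝ) (by rw [hfr, hM'c]; exact hm)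
      (fun j _ => (hF _ (hg j)).1.inter hH) fun I hI hIc => ?_
    rw [hfr] at hIc
    obtain ⟨y, hy, hyH⟩ := hχ I (hI.trans hM') hIc
    rw [hk I hI hIc] at hyH
    rw [Set.mem_iInter₂] at hy
    exact ⟨y, Set.mem_iInter₂.2 fun j hj => ⟨hy j hj, hyH⟩⟩
  rw [Set.mem_iInter₂] at hy
  obtain ⟨j₀, hj₀⟩ : M'.Nonempty := Finset.card_pos.1 (by omega)
  have hyH : y k.1 - x k.1 = (if k.2 then 1 else -1) * (1 / (4 * d)) := (hy j₀ hj₀).2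
  refine ⟨k.1, M', hM'c, ?_⟩
  cases hb : k.2 with
  | true =>
    refine ⟨x, y, by simpa [hb] using hyH, fun j hj => ⟨hx j (hM' hj), (hy j hj).1⟩⟩
  | false =>
    refine ⟨y, x, ?_, fun j hj => ⟨(hy j hj).1, hx j (hM' hj)⟩⟩
    simp only [hb, Bool.false_eq_true, if_false] at hyH
    linarith

end Diameter

/-- Quantitative (p, d+1) theorem: diameter version. -/
theorem quantitative_pq_theorem_diameter (d : ℕ) (hd : 0 < d) :
    ∃ v > (0 : ℝ),
      ∀ p : ℕ, d + 1 ≤ p →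
      ∃ r : ℕ,
      ∀ F : Finset (Set (EuclideanSpace ℝ (Fin d))),
        (∀ C ∈ F, Convex ℝ C ∧ 1 ≤ EMetric.diam C) →
        (∀ P ⊆ F, P.card = p →
          ∃ Q ⊆ P, Q.card = d + 1 ∧
            1 ≤ EMetric.diam (⋂₀ (Q : Set (Set (EuclideanSpace ℝ (Fin d)))))) →
        ∃ T : Finset (Set (EuclideanSpace ℝ (Fin d))),
          T.card ≤ r ∧
          (∀ K ∈ T, Convex ℝ K ∧ ENNReal.ofReal v ≤ EMetric.diam K) ∧
          (∀ C ∈ F, ∃ K ∈ T, K ⊆ C) := by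
  classical
  let V := WithLp 2 (EuclideanSpace ℝ (Fin d) × EuclideanSpace ℝ (Fin d))
  have hfr : Module.finrank ℝ V = d + d := by
    rw [(WithLp.linearEquiv 2 ℝ
      (EuclideanSpace ℝ (Fin d) × EuclideanSpace ℝ (Fin d))).finrank_eq, Module.finrank_prod,
      finrank_euclideanSpace_fin]
  have hd' : (0 : ℝ) < d := by exact_mod_cast hd
  refine ⟨1 / (4 * d), by positivity, fun p _ => ?_⟩
  obtain ⟨N, hN⟩ := exists_common_separated_pair hd p (Module.finrank ℝ V + 1)
    (by rw [hfr]; omega)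
  obtain ⟨r, hr⟩ := exists_bounded_transversal V (Fin d) N
  refine ⟨r, fun F hF hpq => ?_⟩
  let G : Fin d → {C // C ∈ F} → Set V := fun i C =>
    {z | z.fst ∈ C.1 ∧ z.snd ∈ C.1 ∧ z.snd i - z.fst i = 1 / (4 * d)}
  have hG : ∀ i C, Convex ℝ (G i C) := by
    intro i C z hz z' hz' a b ha hb hab
    have hC := (hF C.1 C.2).1
    refine ⟨hC hz.1 hz'.1 ha hb hab, hC hz.2.1 hz'.2.1 ha hb hab, ?_⟩
    have h1 := hz.2.2
    have h2 := hz'.2.2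
    change (a * z.snd i + b * z'.snd i) - (a * z.fst i + b * z'.fst i) = _
    calc _ = a * (z.snd i - z.fst i) + b * (z'.snd i - z'.fst i) := by ring
      _ = _ := by rw [h1, h2, ← add_mul, hab, one_mul]
  obtain ⟨Z, hZc, hZ⟩ := hr {C // C ∈ F} G hG fun g => by
    obtain ⟨i, Q, hQ, x, y, hxy, hmem⟩ := hN F hF hpq (fun j => (g j).1) fun j => (g j).2
    exact ⟨i, Q, hQ, WithLp.toLp 2 (x, y), fun j hj => ⟨(hmem j hj).1, (hmem j hj).2, hxy⟩⟩
  refine ⟨(Z.filter fun z => ∃ i, z.snd i - z.fst i = (1 / (4 * d) : ℝ)).image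
    fun z => segment ℝ z.fst z.snd, ?_, ?_, ?_⟩
  · exact Finset.card_image_le.trans ((Finset.card_filter_le _ _).trans hZc)
  · intro K hK
    obtain ⟨z, hz, rfl⟩ := Finset.mem_image.1 hK
    obtain ⟨i, hi⟩ := (Finset.mem_filter.1 hz).2
    refine ⟨convex_segment _ _, ?_⟩
    refine le_trans ?_ (Metric.edist_le_ediam_of_mem (right_mem_segment ℝ z.fst z.snd)
      (left_mem_segment ℝ z.fst z.snd))
    rw [edist_dist, dist_eq_norm]
    refine ENNReal.ofReal_le_ofReal ?_
    rw [← hi]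
    exact (le_abs_self _).trans (PiLp.norm_apply_le (z.snd - z.fst) i)
  · intro C hC
    obtain ⟨i, z, hz, hz1, hz2, hzi⟩ := hZ ⟨C, hC⟩
    exact ⟨_, Finset.mem_image_of_mem _ (Finset.mem_filter.2 ⟨hz, i, hzi⟩),
      (hF C hC).1.segment_subset hz1 hz2⟩
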